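/- arXiv:1205.6508 — 8 statements merged into one kernel-verified Lean document; each statement's English description precedes it below -/
import Mathlib

section
/- Let γ₁, γ₂ ∈ ℝ. Define W̃(K,τ) = τ² − K²/2 + γ₁((3/2)τK² − τ³) + γ₂ log K on (0,∞) × ℝ, and let V : (0,∞) × ℝ → ℝ be a C² function satisfying the axisymmetric Laplace (Euler–Poisson–Darboux) equation K(V_KK + V_ττ) + V_K = 0. Let U ⊆ ℝ² be open and let K, τ : U → ℝ be differentiable with K(x,y) > 0, and suppose that for every (x,y) ∈ U the hodograph equations hold at (K(x,y), τ(x,y)): y·(−K + 3γ₁τK + γ₂/K) − V_K(K,τ) = 0 and −x + y·(2τ − 3γ₁τ² + (3/2)γ₁K²) − V_τ(K,τ) = 0, and that the Hessian determinant of the function W(K,τ) = −xτ + y·W̃(K,τ) − V(K,τ) (in the variables K, τ) is nonzero at (K(x,y), τ(x,y)). Then (K,τ) solves the quasilinear system K_y + [2τ − γ₁(3τ² − (3/2)K²)]K_x + [K − 3γ₁τK − γ₂/K]τ_x = 0 and τ_y − [K − 3γ₁τK − γ₂/K]K_x + [2τ − γ₁(3τ² − (3/2)K²)]τ_x = 0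 on U. -/
/-- partial derivative in the first (K) variable -/
noncomputable def pd1 (f : ℝ × ℝ → ℝ) (q : ℝ × ℝ) : ℝ := fderiv ℝ f q (1, 0)

/-- partial derivative in the second (τ) variable -/
noncomputable def pd2 (f : ℝ × ℝ → ℝ) (q : ℝ × ℝ) : ℝ := fderiv ℝ f q (0, 1)

theorem pd1_eq_of_hasDerivAt {f : ℝ × ℝ → ℝ} {q : ℝ × ℝ} {d : ℝ} (hf : DifferentiableAt ℝ f q)
    (h : HasDerivAt (fun t => f (t, q.2)) d q.1) : pd1 f q = d :=
  (hf.hasFDerivAt.comp_hasDerivAt (f := fun t => (t, q.2)) q.1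
    ((hasDerivAt_id q.1).prodMk (hasDerivAt_const q.1 q.2))).unique h

theorem pd2_eq_of_hasDerivAt {f : ℝ × ℝ → ℝ} {q : ℝ × ℝ} {d : ℝ} (hf : DifferentiableAt ℝ f q)
    (h : HasDerivAt (fun t => f (q.1, t)) d q.2) : pd2 f q = d :=
  (hf.hasFDerivAt.comp_hasDerivAt (f := fun t => (q.1, t)) q.2
    ((hasDerivAt_const q.2 q.1).prodMk (hasDerivAt_id q.2))).unique h

theorem fderiv_apply_eq_pd (f : ℝ × ℝ → ℝ) (q v : ℝ × ℝ) :
    fderiv ℝ f q v = pd1 f q * v.1 + pd2 f q * v.2 := by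
  have hv : v = v.1 • ((1, 0) : ℝ × ℝ) + v.2 • ((0, 1) : ℝ × ℝ) := by ext <;> simp
  conv_lhs => rw [hv]
  simp only [map_add, map_smul, smul_eq_mul, pd1, pd2]
  ring

theorem ContDiffAt.differentiableAt_fderiv_apply {f : ℝ × ℝ → ℝ} {q : ℝ × ℝ}
    (hf : ContDiffAt ℝ 2 f q) (v : ℝ × ℝ) :
    DifferentiableAt ℝ (fun q => fderiv ℝ f q v) q :=
  ((hf.fderiv_right (m := 1) (by norm_num)).differentiableAt (by norm_num)).clm_apply
    (differentiableAt_const v)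

theorem ContDiffAt.pd2_pd1_eq {f : ℝ × ℝ → ℝ} {q : ℝ × ℝ} (hf : ContDiffAt ℝ 2 f q) :
    pd2 (pd1 f) q = pd1 (pd2 f) q := by
  have hd : DifferentiableAt ℝ (fderiv ℝ f) q :=
    (hf.fderiv_right (m := 1) (by norm_num)).differentiableAt (by norm_num)
  have key (v w : ℝ × ℝ) :
      fderiv ℝ (fun q => fderiv ℝ f q v) q w = fderiv ℝ (fderiv ℝ f) q w v := by
    rw [fderiv_clm_apply hd (differentiableAt_const v)]
    simp
  have hs : IsSymmSndFDerivAt ℝ f q := hf.isSymmSndFDerivAt (by simp)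
  exact (key (1, 0) (0, 1)).trans ((hs (0, 1) (1, 0)).trans (key (0, 1) (1, 0)).symm)

/-- Differentiating an identity `y * g (K, τ) + l (x, y) - h (K, τ) = 0`. -/
theorem fderiv_hodograph {g h K τ : ℝ × ℝ → ℝ} {l : ℝ × ℝ →L[ℝ] ℝ} {p : ℝ × ℝ}
    (hg : DifferentiableAt ℝ g (K p, τ p)) (hh : DifferentiableAt ℝ h (K p, τ p))
    (hK : DifferentiableAt ℝ K p) (hτ : DifferentiableAt ℝ τ p)
    (h0 : ∀ᶠ r in nhds p, l r + r.2 * g (K r, τ r) - h (K r, τ r) = 0) (v : ℝ × ℝ) :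
    l v + v.2 * g (K p, τ p)
      + (p.2 * pd1 g (K p, τ p) - pd1 h (K p, τ p)) * fderiv ℝ K p v
      + (p.2 * pd2 g (K p, τ p) - pd2 h (K p, τ p)) * fderiv ℝ τ p v = 0 := by
  have hc := hK.hasFDerivAt.prodMk hτ.hasFDerivAt
  have hg' := hg.hasFDerivAt.comp (f := fun r => (K r, τ r)) p hc
  have hh' := hh.hasFDerivAt.comp (f := fun r => (K r, τ r)) p hc
  have hd := (l.hasFDerivAt.add ((hasFDerivAt_snd (𝕜 := ℝ) (p := p)).mul hg')).sub hh'
  have hz := (hasFDerivAt_const (𝕜 := ℝ) (0 : ℝ) p).congr_of_eventuallyEq h0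
  have := congrArg (fun L : ℝ × ℝ →L[ℝ] ℝ => L v) (hd.unique hz)
  simp [fderiv_apply_eq_pd g, fderiv_apply_eq_pd h] at this
  linarith

/-- Hodograph solutions built from two `C²` solutions `S`, `V` of the Euler–Poisson–Darboux
equation. -/
theorem hodograph_solution {S V K τ : ℝ × ℝ → ℝ} {p : ℝ × ℝ}
    (hS : ContDiffAt ℝ 2 S (K p, τ p)) (hV : ContDiffAt ℝ 2 V (K p, τ p))
    (hSepd : K p * (pd1 (pd1 S) (K p, τ p) + pd2 (pd2 S) (K p, τ p)) + pd1 S (K p, τ p) = 0)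
    (hVepd : K p * (pd1 (pd1 V) (K p, τ p) + pd2 (pd2 V) (K p, τ p)) + pd1 V (K p, τ p) = 0)
    (hK : DifferentiableAt ℝ K p) (hτ : DifferentiableAt ℝ τ p) (hpos : 0 < K p)
    (h1 : ∀ᶠ r in nhds p, r.2 * pd1 S (K r, τ r) - pd1 V (K r, τ r) = 0)
    (h2 : ∀ᶠ r in nhds p, -r.1 + r.2 * pd2 S (K r, τ r) - pd2 V (K r, τ r) = 0)
    (hHess : (p.2 * pd1 (pd1 S) (K p, τ p) - pd1 (pd1 V) (K p, τ p))
        * (p.2 * pd2 (pd2 S) (K p, τ p) - pd2 (pd2 V) (K p, τ p))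
        - (p.2 * pd1 (pd2 S) (K p, τ p) - pd1 (pd2 V) (K p, τ p)) ^ 2 ≠ 0) :
    pd2 K p + pd2 S (K p, τ p) * pd1 K p - pd1 S (K p, τ p) * pd1 τ p = 0 ∧
      pd2 τ p + pd1 S (K p, τ p) * pd1 K p + pd2 S (K p, τ p) * pd1 τ p = 0 := by
  have e1 := fderiv_hodograph (g := pd1 S) (h := pd1 V) (l := 0)
    (hS.differentiableAt_fderiv_apply (1, 0))
    (hV.differentiableAt_fderiv_apply (1, 0)) hK hτ (by simpa using h1)
  have e2 := fderiv_hodograph (g := pd2 S) (h := pd2 V) (l := -ContinuousLinearMap.fst ℝ ℝ ℝ)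
    (hS.differentiableAt_fderiv_apply (0, 1))
    (hV.differentiableAt_fderiv_apply (0, 1)) hK hτ (by simpa using h2)
  have e1x := e1 (1, 0)
  have e1y := e1 (0, 1)
  have e2x := e2 (1, 0)
  have e2y := e2 (0, 1)
  change _ + _ * pd1 S _ + (_ * pd1 (pd1 S) _ - pd1 (pd1 V) _) * pd1 K p
    + (_ * pd2 (pd1 S) _ - pd2 (pd1 V) _) * pd1 τ p = 0 at e1x
  change _ + _ * pd1 S _ + (_ * pd1 (pd1 S) _ - pd1 (pd1 V) _) * pd2 K p
    + (_ * pd2 (pd1 S) _ - pd2 (pd1 V) _) * pd2 τ p = 0 at e1y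
  change _ + _ * pd2 S _ + (_ * pd1 (pd2 S) _ - pd1 (pd2 V) _) * pd1 K p
    + (_ * pd2 (pd2 S) _ - pd2 (pd2 V) _) * pd1 τ p = 0 at e2x
  change _ + _ * pd2 S _ + (_ * pd1 (pd2 S) _ - pd1 (pd2 V) _) * pd2 K p
    + (_ * pd2 (pd2 S) _ - pd2 (pd2 V) _) * pd2 τ p = 0 at e2y
  rw [hS.pd2_pd1_eq, hV.pd2_pd1_eq] at e1x e1y
  have h1p := h1.self_of_nhds
  have htr : p.2 * pd2 (pd2 S) (K p, τ p) - pd2 (pd2 V) (K p, τ p)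
      = -(p.2 * pd1 (pd1 S) (K p, τ p) - pd1 (pd1 V) (K p, τ p)) := by
    apply mul_left_cancel₀ hpos.ne'
    linear_combination p.2 * hSepd - hVepd - h1p
  rw [htr] at hHess e2x e2y
  simp only [zero_apply, neg_apply, ContinuousLinearMap.coe_fst',
    zero_mul, one_mul, zero_add, add_zero, neg_zero] at e1x e1y e2x e2y
  generalize p.2 * pd1 (pd1 S) (K p, τ p) - pd1 (pd1 V) (K p, τ p) = A at *
  generalize p.2 * pd1 (pd2 S) (K p, τ p) - pd1 (pd2 V) (K p, τ p) = B at *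
  constructor
  · apply mul_left_cancel₀ hHess
    linear_combination (-A) * e1y - B * e2y
      + (pd1 S (K p, τ p) * B - pd2 S (K p, τ p) * A) * e1x
      - (pd2 S (K p, τ p) * B + pd1 S (K p, τ p) * A) * e2x
  · apply mul_left_cancel₀ hHess
    linear_combination (-B) * e1y + A * e2y
      - (pd1 S (K p, τ p) * A + pd2 S (K p, τ p) * B) * e1x
      + (pd2 S (K p, τ p) * A - pd1 S (K p, τ p) * B) * e2x

theorem pd_potential {S : ℝ × ℝ → ℝ} {V W : ℝ × ℝ → ℝ} {x y : ℝ} {q : ℝ × ℝ}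
    (hW : ∀ q : ℝ × ℝ, W q = -x * q.2 + y * S q - V q)
    (hS : DifferentiableAt ℝ S q) (hV : DifferentiableAt ℝ V q) :
    pd1 W q = y * pd1 S q - pd1 V q ∧ pd2 W q = -x + y * pd2 S q - pd2 V q := by
  have hd := ((hasFDerivAt_snd (𝕜 := ℝ) (p := q)).const_mul (-x)).add
    (hS.hasFDerivAt.const_mul y) |>.sub hV.hasFDerivAt
  have hd' := hd.congr_of_eventuallyEq (f₁ := W) (Filter.Eventually.of_forall hW)
  simp [pd1, pd2, hd'.fderiv]

/-- The second-order derivatives of a potential `-x τ + y S - V` in terms of those of `S`, `V`. -/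
theorem hessian_potential {S V W : ℝ × ℝ → ℝ} {x y : ℝ} {q : ℝ × ℝ}
    (hW : ∀ q : ℝ × ℝ, W q = -x * q.2 + y * S q - V q)
    (hS : ContDiffAt ℝ 2 S q) (hV : ContDiffAt ℝ 2 V q) :
    pd1 (pd1 W) q = y * pd1 (pd1 S) q - pd1 (pd1 V) q ∧
      pd2 (pd2 W) q = y * pd2 (pd2 S) q - pd2 (pd2 V) q ∧
      pd1 (pd2 W) q = y * pd1 (pd2 S) q - pd1 (pd2 V) q := by
  have hev : ∀ᶠ r in nhds q,
      pd1 W r = y * pd1 S r - pd1 V r ∧ pd2 W r = -x + y * pd2 S r - pd2 V r := by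
    filter_upwards [hS.eventually (by simp), hV.eventually (by simp)] with r hSr hVr
    exact pd_potential hW (hSr.differentiableAt (by norm_num)) (hVr.differentiableAt (by norm_num))
  have d1 := (((hS.differentiableAt_fderiv_apply (1, 0)).hasFDerivAt.const_mul y).sub
    (hV.differentiableAt_fderiv_apply (1, 0)).hasFDerivAt).congr_of_eventuallyEq
      (f₁ := pd1 W) (hev.mono fun _ h => h.1)
  have d2 := ((((hS.differentiableAt_fderiv_apply (0, 1)).hasFDerivAt.const_mul y).const_add
    (-x)).sub (hV.differentiableAt_fderiv_apply (0, 1)).hasFDerivAt).congr_of_eventuallyEq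
      (f₁ := pd2 W) (hev.mono fun _ h => h.2)
  refine ⟨?_, ?_, ?_⟩
  · exact congrArg (fun L : ℝ × ℝ →L[ℝ] ℝ => L (1, 0)) d1.fderiv
  · exact congrArg (fun L : ℝ × ℝ →L[ℝ] ℝ => L (0, 1)) d2.fderiv
  · exact congrArg (fun L : ℝ × ℝ →L[ℝ] ℝ => L (1, 0)) d2.fderiv

theorem contDiffAt_filament {γ₁ γ₂ : ℝ} {S : ℝ × ℝ → ℝ}
    (hS : ∀ q : ℝ × ℝ, S q =
      q.2 ^ 2 - q.1 ^ 2 / 2 + γ₁ * ((3 / 2) * q.2 * q.1 ^ 2 - q.2 ^ 3) + γ₂ * Real.log q.1)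
    {q : ℝ × ℝ} (hq : 0 < q.1) : ContDiffAt ℝ 2 S q := by
  rw [funext hS]
  have hlog : ContDiffAt ℝ 2 (fun q : ℝ × ℝ => Real.log q.1) q := contDiffAt_fst.log hq.ne'
  fun_prop

theorem pd_filament {γ₁ γ₂ : ℝ} {S : ℝ × ℝ → ℝ}
    (hS : ∀ q : ℝ × ℝ, S q =
      q.2 ^ 2 - q.1 ^ 2 / 2 + γ₁ * ((3 / 2) * q.2 * q.1 ^ 2 - q.2 ^ 3) + γ₂ * Real.log q.1)
    {q : ℝ × ℝ} (hq : 0 < q.1) :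
    pd1 S q = -q.1 + 3 * γ₁ * q.2 * q.1 + γ₂ / q.1 ∧
      pd2 S q = 2 * q.2 - 3 * γ₁ * q.2 ^ 2 + (3 / 2) * γ₁ * q.1 ^ 2 := by
  have hd := (contDiffAt_filament hS hq).differentiableAt (by norm_num)
  constructor
  · apply pd1_eq_of_hasDerivAt hd
    simp only [hS]
    have hsq := hasDerivAt_pow 2 q.1
    refine ((((hsq.div_const 2).const_sub (q.2 ^ 2)).add
      (((hsq.const_mul ((3 / 2) * q.2)).sub_const (q.2 ^ 3)).const_mul γ₁)).add
      ((Real.hasDerivAt_log hq.ne').const_mul γ₂)).congr_deriv ?_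
    norm_num
    ring
  · apply pd2_eq_of_hasDerivAt hd
    simp only [hS]
    refine ((((hasDerivAt_pow 2 q.2).sub_const (q.1 ^ 2 / 2)).add
      (((((hasDerivAt_id q.2).const_mul (3 / 2)).mul_const (q.1 ^ 2)).sub
        (hasDerivAt_pow 3 q.2)).const_mul γ₁)).add_const (γ₂ * Real.log q.1)).congr_deriv ?_
    norm_num
    ring

theorem epd_filament {γ₁ γ₂ : ℝ} {S : ℝ × ℝ → ℝ}
    (hS : ∀ q : ℝ × ℝ, S q =
      q.2 ^ 2 - q.1 ^ 2 / 2 + γ₁ * ((3 / 2) * q.2 * q.1 ^ 2 - q.2 ^ 3) + γ₂ * Real.log q.1)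
    {q : ℝ × ℝ} (hq : 0 < q.1) :
    q.1 * (pd1 (pd1 S) q + pd2 (pd2 S) q) + pd1 S q = 0 := by
  have hc := contDiffAt_filament hS hq
  have h11 : pd1 (pd1 S) q = -1 + 3 * γ₁ * q.2 - γ₂ / q.1 ^ 2 := by
    apply pd1_eq_of_hasDerivAt (hc.differentiableAt_fderiv_apply (1, 0))
    have h : HasDerivAt (fun t => -t + 3 * γ₁ * q.2 * t + γ₂ * t⁻¹)
        (-1 + 3 * γ₁ * q.2 * 1 + γ₂ * -(q.1 ^ 2)⁻¹) q.1 :=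
      ((hasDerivAt_id q.1).neg.add ((hasDerivAt_id q.1).const_mul (3 * γ₁ * q.2))).add
        ((hasDerivAt_inv hq.ne').const_mul γ₂)
    refine (h.congr_of_eventuallyEq ?_).congr_deriv ?_
    · filter_upwards [lt_mem_nhds hq] with t ht
      exact (pd_filament hS (q := (t, q.2)) ht).1
    · ring
  have h22 : pd2 (pd2 S) q = 2 - 6 * γ₁ * q.2 := by
    apply pd2_eq_of_hasDerivAt (hc.differentiableAt_fderiv_apply (0, 1))
    have h := ((((hasDerivAt_id q.2).const_mul 2).sub
      ((hasDerivAt_pow 2 q.2).const_mul (3 * γ₁))).add_const ((3 / 2) * γ₁ * q.1 ^ 2))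
    refine (h.congr_of_eventuallyEq (Filter.Eventually.of_forall fun t => ?_)).congr_deriv ?_
    · exact (pd_filament hS (q := (q.1, t)) hq).2
    · norm_num
      ring
  rw [h11, h22, (pd_filament hS hq).1]
  field_simp
  ring

/-- hodograph solutions, i.e. critical points of
W(K,τ) = −xτ + y·W̃(K,τ) − V(K,τ), with W̃(K,τ) = τ² − K²/2 + γ₁((3/2)τK² − τ³) + γ₂ log K
and V a C² solution of the Euler–Poisson–Darboux equation K(V_KK + V_ττ) + V_K = 0 on
(0,∞) × ℝ, give solutions of the quasiclassical intrinsic vortex filament system with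
axial flow (γ₁) and dToda (γ₂) contributions, wherever the Hessian of W is nondegenerate. -/
theorem stmt_0 (γ₁ γ₂ : ℝ)
    (Wt : ℝ × ℝ → ℝ)
    (hWt : ∀ q : ℝ × ℝ, Wt q =
      q.2 ^ 2 - q.1 ^ 2 / 2 + γ₁ * ((3 / 2) * q.2 * q.1 ^ 2 - q.2 ^ 3) + γ₂ * Real.log q.1)
    (V : ℝ × ℝ → ℝ)
    (hV : ContDiffOn ℝ 2 V {q : ℝ × ℝ | 0 < q.1})
    (hVepd : ∀ q : ℝ × ℝ, 0 < q.1 → q.1 * (pd1 (pd1 V) q + pd2 (pd2 V) q) + pd1 V q = 0)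
    (U : Set (ℝ × ℝ)) (hU : IsOpen U)
    (K τ : ℝ × ℝ → ℝ)
    (hK : ∀ p ∈ U, DifferentiableAt ℝ K p)
    (hτ : ∀ p ∈ U, DifferentiableAt ℝ τ p)
    (hKpos : ∀ p ∈ U, 0 < K p)
    (hodo1 : ∀ p ∈ U,
      p.2 * (-(K p) + 3 * γ₁ * τ p * K p + γ₂ / K p) - pd1 V (K p, τ p) = 0)
    (hodo2 : ∀ p ∈ U,
      -p.1 + p.2 * (2 * τ p - 3 * γ₁ * (τ p) ^ 2 + (3 / 2) * γ₁ * (K p) ^ 2)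
        - pd2 V (K p, τ p) = 0)
    (W : ℝ → ℝ → ℝ × ℝ → ℝ)
    (hW : ∀ (x y : ℝ) (q : ℝ × ℝ), W x y q = -x * q.2 + y * Wt q - V q)
    (hHess : ∀ p ∈ U,
      pd1 (pd1 (W p.1 p.2)) (K p, τ p) * pd2 (pd2 (W p.1 p.2)) (K p, τ p)
        - pd1 (pd2 (W p.1 p.2)) (K p, τ p) ^ 2 ≠ 0) :
    ∀ p ∈ U,
      pd2 K p + (2 * τ p - γ₁ * (3 * (τ p) ^ 2 - (3 / 2) * (K p) ^ 2)) * pd1 K p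
          + (K p - 3 * γ₁ * τ p * K p - γ₂ / K p) * pd1 τ p = 0 ∧
      pd2 τ p - (K p - 3 * γ₁ * τ p * K p - γ₂ / K p) * pd1 K p
          + (2 * τ p - γ₁ * (3 * (τ p) ^ 2 - (3 / 2) * (K p) ^ 2)) * pd1 τ p = 0 := by
  intro p hp
  have hpos := hKpos p hp
  have hUp := hU.mem_nhds hp
  have hVc : ContDiffAt ℝ 2 V (K p, τ p) :=
    hV.contDiffAt ((isOpen_lt continuous_const continuous_fst).mem_nhds hpos)
  have hSc : ContDiffAt ℝ 2 Wt (K p, τ p) := contDiffAt_filament hWt hpos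
  obtain ⟨e11, e22, e12⟩ := hessian_potential (hW p.1 p.2) hSc hVc
  have hH := hHess p hp
  rw [e11, e22, e12] at hH
  have hmain := hodograph_solution hSc hVc (epd_filament hWt (q := (K p, τ p)) hpos)
    (hVepd (K p, τ p) hpos) (hK p hp) (hτ p hp) hpos
    (by
      filter_upwards [hUp] with r hr
      rw [(pd_filament hWt (q := (K r, τ r)) (hKpos r hr)).1]
      exact hodo1 r hr)
    (by
      filter_upwards [hUp] with r hr
      rw [(pd_filament hWt (q := (K r, τ r)) (hKpos r hr)).2]
      exact hodo2 r hr)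
    hH
  rw [(pd_filament hWt (q := (K p, τ p)) hpos).1, (pd_filament hWt (q := (K p, τ p)) hpos).2]
    at hmain
  exact ⟨by linear_combination hmain.1, by linear_combination hmain.2⟩
end

section
/- Let U ⊆ ℝ² be open and K, τ : U → ℝ differentiable. Define β = −τ + iK : U → ℂ. Then (K, τ) satisfies the dispersionless Da Rios system K_y = −2K_x τ − K τ_x, τ_y = K K_x − 2τ τ_x on U if and only if β satisfies the complex equation β_y = (1/2)(3β + β̄) β_x on U. -/
/-- The derivative of `-f + i g` for real-valued `f` and `g`. -/
theorem fderiv_neg_ofReal_add_I_mul_ofReal {E : Type*} [NormedAddCommGroup E] [NormedSpace ℝ E]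
    {f g : E → ℝ} {p : E} (hf : DifferentiableAt ℝ f p) (hg : DifferentiableAt ℝ g p) (v : E) :
    fderiv ℝ (fun q => -(f q : ℂ) + Complex.I * (g q : ℂ)) p v =
      -(fderiv ℝ f p v : ℂ) + Complex.I * (fderiv ℝ g p v : ℂ) := by
  have hf' := Complex.ofRealCLM.hasFDerivAt.comp p hf.hasFDerivAt
  have hg' := Complex.ofRealCLM.hasFDerivAt.comp p hg.hasFDerivAt
  have h : HasFDerivAt (fun q => -(f q : ℂ) + Complex.I * (g q : ℂ)) _ p :=
    hf'.neg.add (hg'.const_mul Complex.I)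
  rw [h.fderiv]
  simp

/-- the dispersionless Da Rios system for (K, τ) is equivalent to the
complex Riemann-invariant equation β_y = (1/2)(3β + β̄) β_x for β = −τ + iK. -/
theorem stmt_2 (U : Set (ℝ × ℝ)) (hU : IsOpen U)
    (K τ : ℝ × ℝ → ℝ)
    (hK : ∀ p ∈ U, DifferentiableAt ℝ K p)
    (hτ : ∀ p ∈ U, DifferentiableAt ℝ τ p)
    (β : ℝ × ℝ → ℂ)
    (hβ : ∀ p, β p = -(τ p : ℂ) + Complex.I * (K p : ℂ)) :
    (∀ p ∈ U,
        fderiv ℝ K p (0, 1) = -2 * fderiv ℝ K p (1, 0) * τ p - K p * fderiv ℝ τ p (1, 0) ∧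
        fderiv ℝ τ p (0, 1) = K p * fderiv ℝ K p (1, 0) - 2 * τ p * fderiv ℝ τ p (1, 0)) ↔
    (∀ p ∈ U,
        fderiv ℝ β p (0, 1) =
          (1 / 2) * (3 * β p + starRingEnd ℂ (β p)) * fderiv ℝ β p (1, 0)) := by
  obtain rfl : β = fun q => -(τ q : ℂ) + Complex.I * (K q : ℂ) := funext hβ
  refine forall₂_congr fun p hp => ?_
  rw [fderiv_neg_ofReal_add_I_mul_ofReal (hτ p hp) (hK p hp),
    fderiv_neg_ofReal_add_I_mul_ofReal (hτ p hp) (hK p hp)]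
  have hcoef : (1 / 2 : ℂ) * (3 * (-(τ p : ℂ) + Complex.I * (K p : ℂ)) +
      starRingEnd ℂ (-(τ p : ℂ) + Complex.I * (K p : ℂ))) =
      -2 * (τ p : ℂ) + Complex.I * (K p : ℂ) := by
    simp only [map_add, map_neg, map_mul, Complex.conj_ofReal, Complex.conj_I]
    ring
  rw [hcoef, Complex.ext_iff]
  simp only [Complex.add_re, Complex.add_im, Complex.neg_re, Complex.neg_im, Complex.mul_re,
    Complex.mul_im, Complex.ofReal_re, Complex.ofReal_im, Complex.I_re, Complex.I_im,
    Complex.re_ofNat, Complex.im_ofNat]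
  constructor <;> rintro ⟨h₁, h₂⟩ <;> constructor <;> linarith
end

section
/- Let γ₁, γ₂ ∈ ℝ and define the rational function of two complex variables λ(β,γ) = (1/2)(3β + γ) + γ₁(3/8)(5β² + 2βγ + γ²) + 2γ₂/(β − γ). Then for all β, γ ∈ ℂ with β ≠ γ, ∂λ/∂γ (β,γ) = (λ(β,γ) − λ(γ,β)) / (2(β − γ)). -/
/-- the characteristic velocity λ(β,γ) of the quasiclassical vortex filament
equation satisfies ∂λ/∂γ = (λ(β,γ) − λ(γ,β)) / (2(β − γ)). -/
theorem stmt_4 (γ₁ γ₂ : ℝ) (lam : ℂ → ℂ → ℂ)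
    (hlam : ∀ β γ : ℂ, lam β γ =
      (1 / 2) * (3 * β + γ) + (γ₁ : ℂ) * (3 / 8) * (5 * β ^ 2 + 2 * β * γ + γ ^ 2)
        + 2 * (γ₂ : ℂ) / (β - γ)) :
    ∀ β γ : ℂ, β ≠ γ →
      deriv (fun g => lam β g) γ = (lam β γ - lam γ β) / (2 * (β - γ)) := by
  intro β γ hne
  have hsub : β - γ ≠ 0 := sub_ne_zero.mpr hne
  have hlin : HasDerivAt (fun g : ℂ => (1 / 2) * (3 * β + g)) (1 / 2) γ := by
    simpa using ((hasDerivAt_id γ).const_add (3 * β)).const_mul (1 / 2 : ℂ)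
  have hquad : HasDerivAt
      (fun g : ℂ => (γ₁ : ℂ) * (3 / 8) * (5 * β ^ 2 + 2 * β * g + g ^ 2))
      ((γ₁ : ℂ) * (3 / 8) * (2 * β + 2 * γ)) γ := by
    simpa using ((((hasDerivAt_id γ).const_mul (2 * β)).const_add (5 * β ^ 2)).add
      (hasDerivAt_pow 2 γ)).const_mul ((γ₁ : ℂ) * (3 / 8))
  have hpole : HasDerivAt (fun g : ℂ => 2 * (γ₂ : ℂ) / (β - g))
      (2 * (γ₂ : ℂ) / (β - γ) ^ 2) γ := by
    simpa using (hasDerivAt_const γ (2 * (γ₂ : ℂ))).fun_div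
      ((hasDerivAt_id γ).const_sub β) hsub
  have hderiv := ((hlin.fun_add hquad).fun_add hpole).deriv
  simp only [hlam]
  rw [hderiv, ← neg_sub β γ, div_neg]
  field_simp
  ring
end

section
/- Let γ₁, γ₂ ∈ ℝ and define, for β, γ ∈ ℂ with (β − γ)/(2i) not a nonpositive real number, W̃(β,γ) = (1/8)(3β² + 2βγ + 3γ²) + (γ₁/16)(5β³ + 3β²γ + 3βγ² + 5γ³) + γ₂·Log((β − γ)/(2i)), where Log is the principal branch of the complex logarithm. Then W̃ satisfies the Euler–Poisson–Darboux equation E(1/2,1/2): (β − γ)·∂²W̃/∂β∂γ = (1/2)(∂W̃/∂β − ∂W̃/∂γ) at every such (β,γ). -/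
theorem hasDerivAt_log_sub_div_left {b g : ℂ}
    (h : (b - g) / (2 * Complex.I) ∈ Complex.slitPlane) :
    HasDerivAt (fun x : ℂ => Complex.log ((x - g) / (2 * Complex.I))) (1 / (b - g)) b := by
  have hne : b - g ≠ 0 := by
    intro h0
    simp [h0] at h
  have hd := (((hasDerivAt_id' b).sub_const g).div_const (2 * Complex.I)).clog h
  refine hd.congr_deriv ?_
  field_simp

theorem hasDerivAt_log_sub_div_right {b g : ℂ}
    (h : (b - g) / (2 * Complex.I) ∈ Complex.slitPlane) :
    HasDerivAt (fun x : ℂ => Complex.log ((b - x) / (2 * Complex.I))) (-1 / (b - g)) g := by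
  have hne : b - g ≠ 0 := by
    intro h0
    simp [h0] at h
  have hd := (((hasDerivAt_id' g).const_sub b).div_const (2 * Complex.I)).clog h
  refine hd.congr_deriv ?_
  field_simp

theorem hasDerivAt_cubic (c₀ c₁ c₂ c₃ x : ℂ) :
    HasDerivAt (fun y : ℂ => c₀ + c₁ * y + c₂ * y ^ 2 + c₃ * y ^ 3)
      (c₁ + 2 * c₂ * x + 3 * c₃ * x ^ 2) x := by
  have h := ((((hasDerivAt_id' x).const_mul c₁).const_add c₀).add
    ((hasDerivAt_pow 2 x).const_mul c₂)).add ((hasDerivAt_pow 3 x).const_mul c₃)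
  refine h.congr_deriv ?_
  push_cast
  ring

/-- the potential W̃ satisfies the Euler–Poisson–Darboux equation E(1/2,1/2):
(β − γ) W̃_βγ = (1/2)(W̃_β − W̃_γ), away from the branch cut of the logarithm. -/
theorem stmt_6 (γ₁ γ₂ : ℝ) (Wt : ℂ → ℂ → ℂ)
    (hWt : ∀ β γ : ℂ, Wt β γ =
      (1 / 8) * (3 * β ^ 2 + 2 * β * γ + 3 * γ ^ 2)
        + ((γ₁ : ℂ) / 16) * (5 * β ^ 3 + 3 * β ^ 2 * γ + 3 * β * γ ^ 2 + 5 * γ ^ 3)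
        + (γ₂ : ℂ) * Complex.log ((β - γ) / (2 * Complex.I))) :
    ∀ β γ : ℂ, (β - γ) / (2 * Complex.I) ∈ Complex.slitPlane →
      (β - γ) * deriv (fun g => deriv (fun b => Wt b g) β) γ =
        (1 / 2) * (deriv (fun b => Wt b γ) β - deriv (fun g => Wt β g) γ) := by
  have hβ : ∀ b g : ℂ, (b - g) / (2 * Complex.I) ∈ Complex.slitPlane →
      HasDerivAt (fun x => Wt x g) ((1 / 8) * (6 * b + 2 * g)
        + ((γ₁ : ℂ) / 16) * (15 * b ^ 2 + 6 * b * g + 3 * g ^ 2) + γ₂ * (1 / (b - g))) b := by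
    intro b g h
    have hd := (hasDerivAt_cubic (3 / 8 * g ^ 2 + γ₁ / 16 * (5 * g ^ 3))
      (1 / 4 * g + γ₁ / 16 * (3 * g ^ 2)) (3 / 8 + γ₁ / 16 * (3 * g)) (γ₁ / 16 * 5) b).add
      ((hasDerivAt_log_sub_div_left h).const_mul (γ₂ : ℂ))
    refine (hd.congr_deriv (by ring)).congr_of_eventuallyEq (.of_forall fun x => ?_)
    simp only [hWt, Pi.add_apply]
    ring
  have hγ : ∀ b g : ℂ, (b - g) / (2 * Complex.I) ∈ Complex.slitPlane →
      HasDerivAt (fun x => Wt b x) ((1 / 8) * (2 * b + 6 * g)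
        + ((γ₁ : ℂ) / 16) * (3 * b ^ 2 + 6 * b * g + 15 * g ^ 2) + γ₂ * (-1 / (b - g))) g := by
    intro b g h
    have hd := (hasDerivAt_cubic (3 / 8 * b ^ 2 + γ₁ / 16 * (5 * b ^ 3))
      (1 / 4 * b + γ₁ / 16 * (3 * b ^ 2)) (3 / 8 + γ₁ / 16 * (3 * b)) (γ₁ / 16 * 5) g).add
      ((hasDerivAt_log_sub_div_right h).const_mul (γ₂ : ℂ))
    refine (hd.congr_deriv (by ring)).congr_of_eventuallyEq (.of_forall fun x => ?_)
    simp only [hWt, Pi.add_apply]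
    ring
  intro β γ h
  have hne : β - γ ≠ 0 := by
    intro h0
    simp [h0] at h
  have hcont : ContinuousAt (fun g : ℂ => (β - g) / (2 * Complex.I)) γ := by fun_prop
  have hev : (fun g => deriv (fun b => Wt b g) β) =ᶠ[nhds γ] fun g =>
      (1 / 8) * (6 * β + 2 * g) + ((γ₁ : ℂ) / 16) * (15 * β ^ 2 + 6 * β * g + 3 * g ^ 2)
        + γ₂ * (1 / (β - g)) := by
    filter_upwards [hcont.eventually (Complex.isOpen_slitPlane.mem_nhds h)] with g hg
    exact (hβ β g hg).deriv
  have hmixed : HasDerivAt (fun g => deriv (fun b => Wt b g) β)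
      (1 / 4 + (γ₁ : ℂ) / 16 * (6 * β + 6 * γ) + γ₂ * (1 / (β - γ) ^ 2)) γ := by
    have hd := (hasDerivAt_cubic (3 / 4 * β + γ₁ / 16 * (15 * β ^ 2))
      (1 / 4 + γ₁ / 16 * (6 * β)) (γ₁ / 16 * 3) 0 γ).add
      ((((hasDerivAt_id' γ).const_sub β).inv hne).const_mul (γ₂ : ℂ))
    refine (hd.congr_deriv (by ring)).congr_of_eventuallyEq
      (hev.trans (.of_forall fun x => ?_))
    simp only [Pi.add_apply, Pi.inv_apply]
    ring
  rw [hmixed.deriv, (hβ β γ h).deriv, (hγ β γ h).deriv]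
  field_simp
  ring
end

section
/- Let γ₁, γ₂, x, y ∈ ℝ and define W(K,τ) = −xτ + y·(τ² − K²/2 + γ₁((3/2)τK² − τ³) + γ₂·log K) on (0,∞) × ℝ. Then W satisfies the axisymmetric three-dimensional Laplace (Beltrami) equation K·(W_KK + W_ττ) + W_K = 0 at every point (K,τ) with K > 0. -/
/-- the generating function W(K,τ) = −xτ + y·W̃(K,τ) satisfies the
axisymmetric three-dimensional Laplace (Beltrami) equation K(W_KK + W_ττ) + W_K = 0
for K > 0. -/
theorem stmt_7 (γ₁ γ₂ x y : ℝ) (W : ℝ → ℝ → ℝ)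
    (hW : ∀ K τ : ℝ, W K τ =
      -x * τ + y * (τ ^ 2 - K ^ 2 / 2 + γ₁ * ((3 / 2) * τ * K ^ 2 - τ ^ 3)
        + γ₂ * Real.log K)) :
    ∀ K τ : ℝ, 0 < K →
      K * (deriv (fun k => deriv (fun k' => W k' τ) k) K
            + deriv (fun t => deriv (fun t' => W K t') t) τ)
        + deriv (fun k => W k τ) K = 0 := by
  intro K τ hK
  have hWK : ∀ k : ℝ, k ≠ 0 →
      deriv (fun k' => W k' τ) k = y * (-k + 3 * γ₁ * τ * k + γ₂ * k⁻¹) := by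
    intro k hk
    have hpow : HasDerivAt (fun k' : ℝ => k' ^ 2) (2 * k) k := by
      simpa using hasDerivAt_pow 2 k
    have h := ((((hpow.div_const 2).const_sub (τ ^ 2)).add
      (((hpow.const_mul (3 / 2 * τ)).sub_const (τ ^ 3)).const_mul γ₁)).add
      ((Real.hasDerivAt_log hk).const_mul γ₂)).const_mul y |>.const_add (-x * τ)
    simp only [hW]
    refine (h.congr_deriv ?_).deriv
    ring
  have hWKK : deriv (fun k => deriv (fun k' => W k' τ) k) K
      = y * (-1 + 3 * γ₁ * τ - γ₂ / K ^ 2) := by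
    have heq : (fun k => deriv (fun k' => W k' τ) k) =ᶠ[nhds K]
        fun k => y * (-k + 3 * γ₁ * τ * k + γ₂ * k⁻¹) :=
      (eventually_ne_nhds hK.ne').mono hWK
    rw [heq.deriv_eq]
    have h := (((hasDerivAt_id K).neg.add ((hasDerivAt_id K).const_mul (3 * γ₁ * τ))).add
      ((hasDerivAt_inv hK.ne').const_mul γ₂)).const_mul y
    refine (h.congr_deriv ?_).deriv
    ring
  have hWτ : (fun t => deriv (fun t' => W K t') t) =
      fun t => -x + y * (2 * t + γ₁ * (3 / 2 * K ^ 2 - 3 * t ^ 2)) := by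
    funext t
    have hsq : HasDerivAt (fun t' : ℝ => t' ^ 2) (2 * t) t := by
      simpa using hasDerivAt_pow 2 t
    have hcube : HasDerivAt (fun t' : ℝ => t' ^ 3) (3 * t ^ 2) t := by
      simpa using hasDerivAt_pow 3 t
    have h := ((hasDerivAt_id t).const_mul (-x)).add
      ((((hsq.sub_const (K ^ 2 / 2)).add
        (((((hasDerivAt_id t).const_mul (3 / 2 : ℝ)).mul_const (K ^ 2)).sub hcube).const_mul
          γ₁)).add_const (γ₂ * Real.log K)).const_mul y)
    simp only [hW]
    refine (h.congr_deriv ?_).deriv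
    ring
  have hWττ : deriv (fun t => deriv (fun t' => W K t') t) τ = y * (2 - 6 * γ₁ * τ) := by
    rw [hWτ]
    have hsq : HasDerivAt (fun t : ℝ => t ^ 2) (2 * τ) τ := by
      simpa using hasDerivAt_pow 2 τ
    have h := ((((hasDerivAt_id τ).const_mul (2 : ℝ)).add
      (((hsq.const_mul 3).const_sub (3 / 2 * K ^ 2)).const_mul γ₁)).const_mul y).const_add (-x)
    refine (h.congr_deriv ?_).deriv
    ring
  rw [hWKK, hWττ, hWK K hK.ne']
  field_simp
  ring
end

section
/- Let U ⊆ ℝ² be open and K, τ : U → ℝ differentiable with K > 0 on U. Define u = K² and v = 2τ. Then (K, τ) satisfies the dispersionless Da Rios system K_y = −2K_x τ − K τ_x, τ_y = K K_x − 2τ τ_x on U if and only if (u, v) satisfies the hydrodynamic system u_y + (uv)_x = 0, v_y + v·v_x − u_x = 0 on U. -/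
/-- under u = K², v = 2τ (K > 0), the dispersionless Da Rios system is
equivalent to the hydrodynamic system u_y + (uv)_x = 0, v_y + v v_x − u_x = 0. -/
theorem stmt_11 (U : Set (ℝ × ℝ)) (hU : IsOpen U)
    (K τ : ℝ × ℝ → ℝ)
    (hK : ∀ p ∈ U, DifferentiableAt ℝ K p)
    (hτ : ∀ p ∈ U, DifferentiableAt ℝ τ p)
    (hKpos : ∀ p ∈ U, 0 < K p)
    (u v : ℝ × ℝ → ℝ)
    (hu : ∀ p, u p = K p ^ 2) (hv : ∀ p, v p = 2 * τ p) :
    (∀ p ∈ U,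
        fderiv ℝ K p (0, 1) = -2 * fderiv ℝ K p (1, 0) * τ p - K p * fderiv ℝ τ p (1, 0) ∧
        fderiv ℝ τ p (0, 1) = K p * fderiv ℝ K p (1, 0) - 2 * τ p * fderiv ℝ τ p (1, 0)) ↔
    (∀ p ∈ U,
        fderiv ℝ u p (0, 1) + fderiv ℝ (fun q => u q * v q) p (1, 0) = 0 ∧
        fderiv ℝ v p (0, 1) + v p * fderiv ℝ v p (1, 0) - fderiv ℝ u p (1, 0) = 0) := by
  obtain rfl : u = fun p => K p ^ 2 := funext hu
  obtain rfl : v = fun p => 2 * τ p := funext hv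
  refine forall₂_congr fun p hp => ?_
  have hKp := (hK p hp).hasFDerivAt
  have hτp := (hτ p hp).hasFDerivAt
  have hKne : K p ≠ 0 := (hKpos p hp).ne'
  have hu' := hKp.pow 2
  have hv' := hτp.const_mul 2
  have huv := hu'.mul hv'
  have hfu : fderiv ℝ (fun q => K q ^ 2) p = _ := hu'.fderiv
  have hfv : fderiv ℝ (fun q => 2 * τ q) p = _ := hv'.fderiv
  have hfuv : fderiv ℝ (fun q => K q ^ 2 * (2 * τ q)) p = _ := huv.fderiv
  rw [hfu, hfv, hfuv]
  simp only [add_apply, smul_apply, smul_eq_mul, nsmul_eq_mul]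
  refine and_congr ⟨fun h => ?_, fun h => ?_⟩ ⟨fun h => ?_, fun h => ?_⟩
  · rw [h]; push_cast; ring
  · apply mul_left_cancel₀ hKne
    push_cast at h
    linear_combination h / 2
  · rw [h]; push_cast; ring
  · push_cast at h
    linear_combination h / 2
end

section
/- Let U ⊆ ℝ² be open and K, τ : U → ℝ of class C² with K > 0 on U, satisfying the first-order system τ_y = K_x/K and K_y = −τ_x/K on U. Then the function φ = 2·log K satisfies the dispersionless Toda (Boyer–Finley) equation φ_xx + (e^φ)_yy = 0 on U. -/
/-- if (K, τ) of class C² with K > 0 satisfies τ_y = K_x/K and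
K_y = −τ_x/K, then φ = 2 log K satisfies the dispersionless Toda (Boyer–Finley)
equation φ_xx + (e^φ)_yy = 0. -/
theorem stmt_12 (U : Set (ℝ × ℝ)) (hU : IsOpen U)
    (K τ : ℝ × ℝ → ℝ)
    (hK : ContDiffOn ℝ 2 K U) (hτ : ContDiffOn ℝ 2 τ U)
    (hKpos : ∀ p ∈ U, 0 < K p)
    (hsys : ∀ p ∈ U,
      fderiv ℝ τ p (0, 1) = fderiv ℝ K p (1, 0) / K p ∧
      fderiv ℝ K p (0, 1) = -(fderiv ℝ τ p (1, 0)) / K p)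
    (φ : ℝ × ℝ → ℝ) (hφ : ∀ p, φ p = 2 * Real.log (K p)) :
    ∀ p ∈ U,
      fderiv ℝ (fun q => fderiv ℝ φ q (1, 0)) p (1, 0)
        + fderiv ℝ (fun q => fderiv ℝ (fun r => Real.exp (φ r)) q (0, 1)) p (0, 1) = 0 := by
  intro p hp
  have hKd : ∀ q ∈ U, DifferentiableAt ℝ K q := fun q hq =>
    (hK.contDiffAt (hU.mem_nhds hq)).differentiableAt (by norm_num)
  have hφ_x : (fun q => fderiv ℝ φ q (1, 0)) =ᶠ[nhds p]
      fun q => 2 * fderiv ℝ τ q (0, 1) := by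
    filter_upwards [hU.mem_nhds hp] with q hq
    have hd : HasFDerivAt φ ((2 : ℝ) • ((K q)⁻¹ • fderiv ℝ K q)) q := by
      rw [funext hφ]
      exact ((hKd q hq).hasFDerivAt.log (hKpos q hq).ne').const_mul 2
    rw [hd.fderiv, (hsys q hq).1]
    simp only [FunLike.coe_smul, Pi.smul_apply, smul_eq_mul]
    ring
  have hexp_y : (fun q => fderiv ℝ (fun r => Real.exp (φ r)) q (0, 1)) =ᶠ[nhds p]
      fun q => (-2) * fderiv ℝ τ q (1, 0) := by
    filter_upwards [hU.mem_nhds hp] with q hq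
    have hsq : (fun r => Real.exp (φ r)) =ᶠ[nhds q] fun r => K r * K r := by
      filter_upwards [hU.mem_nhds hq] with r hr
      rw [hφ, two_mul, Real.exp_add, Real.exp_log (hKpos r hr)]
    have hd := (hKd q hq).hasFDerivAt.mul (hKd q hq).hasFDerivAt
    have hne := (hKpos q hq).ne'
    rw [hsq.fderiv_eq]
    erw [hd.fderiv]
    simp only [FunLike.coe_add, FunLike.coe_smul, Pi.add_apply, Pi.smul_apply, smul_eq_mul,
      (hsys q hq).2]
    field_simp
    ring
  have hτp : ContDiffAt ℝ 2 τ p := hτ.contDiffAt (hU.mem_nhds hp)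
  have hdτ : DifferentiableAt ℝ (fderiv ℝ τ) p :=
    (hτp.fderiv_right (m := 1) (by norm_num)).differentiableAt (by norm_num)
  have hsymm : IsSymmSndFDerivAt ℝ τ p := hτp.isSymmSndFDerivAt (by simp)
  have hsecond (c : ℝ) (v w : ℝ × ℝ) :
      fderiv ℝ (fun q => c * fderiv ℝ τ q v) p w = c * fderiv ℝ (fderiv ℝ τ) p w v := by
    have hd : HasFDerivAt (fun q => fderiv ℝ τ q v)
        ((ContinuousLinearMap.apply ℝ ℝ v).comp (fderiv ℝ (fderiv ℝ τ) p)) p :=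
      (ContinuousLinearMap.apply ℝ ℝ v).hasFDerivAt.comp p hdτ.hasFDerivAt
    rw [(hd.const_mul c).fderiv]
    simp
  rw [hφ_x.fderiv_eq, hexp_y.fderiv_eq, hsecond, hsecond, hsymm.eq (1, 0) (0, 1)]
  ring
end

section
/- Let ã, z* ∈ ℂ with ã ≠ 0 and let c ∈ ℂ satisfy c⁴ = ã. Then for every β* ∈ ℂ, writing Ũ = Re(c·β*) and Ṽ = Im(c·β*), one has z*·β* + z̄*·β̄* + (ã/24)·β*⁴ + (ā̃/24)·β̄*⁴ = l·Ũ + m·Ṽ + (1/12)Ũ⁴ − (1/2)Ũ²Ṽ² + (1/12)Ṽ⁴, where l = 2·Re(z*/c) and m = −2·Im(z*/c). -/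
/-- The real part of `p w + w ^ 4 / 24`, doubled, in the real coordinates of `w`. -/
theorem quartic_add_conj_eq (p w : ℂ) :
    p * w + starRingEnd ℂ p * starRingEnd ℂ w + w ^ 4 / 24 + starRingEnd ℂ w ^ 4 / 24
      = ((2 * p.re * w.re + -2 * p.im * w.im + (1 / 12) * w.re ^ 4
          - (1 / 2) * w.re ^ 2 * w.im ^ 2 + (1 / 12) * w.im ^ 4 : ℝ) : ℂ) := by
  obtain ⟨a, b⟩ := p
  obtain ⟨x, y⟩ := w
  simp only [Complex.mk_eq_add_mul_I, map_add, map_mul, Complex.conj_ofReal, Complex.conj_I]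
  simp
  linear_combination (2 * (b : ℂ) * y + (x : ℂ) ^ 2 * y ^ 2 / 2
    + (y : ℂ) ^ 4 / 12 * (Complex.I ^ 2 - 1)) * Complex.I_sq

/-- with c⁴ = ã ≠ 0, Ũ = Re(cβ*), Ṽ = Im(cβ*), l = 2Re(z*/c),
m = −2Im(z*/c), the principal part of the generating function at a catastrophe point of
the deeper singular sector takes the X₉ normal form
lŨ + mṼ + Ũ⁴/12 − Ũ²Ṽ²/2 + Ṽ⁴/12. -/
theorem stmt_15 (ta zs c : ℂ) (ha : ta ≠ 0) (hc : c ^ 4 = ta) :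
    ∀ (βs : ℂ) (U V l m : ℝ),
      U = (c * βs).re → V = (c * βs).im →
      l = 2 * (zs / c).re → m = -2 * (zs / c).im →
      zs * βs + starRingEnd ℂ zs * starRingEnd ℂ βs
          + ta / 24 * βs ^ 4 + starRingEnd ℂ ta / 24 * (starRingEnd ℂ βs) ^ 4
        = ((l * U + m * V + (1 / 12) * U ^ 4 - (1 / 2) * U ^ 2 * V ^ 2
            + (1 / 12) * V ^ 4 : ℝ) : ℂ) := by
  rintro βs U V l m rfl rfl rfl rfl
  have hc0 : c ≠ 0 := by
    rintro rfl
    exact ha (by simpa using hc.symm)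
  have hz : zs * βs = zs / c * (c * βs) := by field_simp
  have hq : ta / 24 * βs ^ 4 = (c * βs) ^ 4 / 24 := by rw [← hc]; ring
  have hz' := congrArg (starRingEnd ℂ) hz
  have hq' := congrArg (starRingEnd ℂ) hq
  simp only [map_mul (starRingEnd ℂ) zs, map_mul (starRingEnd ℂ) (ta / 24), map_div₀, map_pow,
    map_ofNat] at hz' hq'
  rw [hz', hq', hz, hq, map_mul (starRingEnd ℂ) (zs / c)]
  exact quartic_add_conj_eq (zs / c) (c * βs)
end
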